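/- Let X be a normed space and Θ ⊆ X nonempty compact. Let 𝒰 be the set of bounded functions u : [0,∞) → ℝ, with ‖u‖∞ := sup_{t≥0}|u(t)|, and for each u ∈ 𝒰 let φ_u : [0,∞) × X → X satisfy: (a) φ_u(0,x) = x; (b) t ↦ φ_u(t,x) is continuous; (c) φ_u(t+τ, x) = φ_{u(·+τ)}(t, φ_u(τ,x)) for all t,τ ≥ 0 and x ∈ X. Let r₀ > 0, let V : {x : dist(x,Θ) ≤ r₀} → [0,∞) satisfy |V(x) − V(y)| ≤ ‖x−y‖, let ψ̲, ψ̄ ∈ 𝒦∞ satisfy ψ̲(dist(x,Θ)) ≤ V(x) ≤ ψ̄(dist(x,Θ)) for dist(x,Θ) ≤ r₀, and let α, χ ∈ 𝒦∞ be such that for every u ∈ 𝒰 and every x with χ(‖u‖∞) ≤ dist(x,Θ) < r₀ one has limsup_{t→0+} ( V(φ_u(t,x)) − V(x) )/t ≤ −α(dist(x,Θ)). Fix u ∈ 𝒰 with ψ̲⁻¹( ψ̄( χ(‖u‖∞) ) ) < r₀. Then the set M_u := { x : dist(x,Θ) ≤ r₀ and V(x) ≤ ψ̄(χ(‖u‖∞))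 } is forward invariant: for every x ∈ M_u and every t ≥ 0, φ_u(t,x) ∈ M_u; in particular dist(φ_u(t,x), Θ) ≤ ψ̲⁻¹( ψ̄( χ(‖u‖∞) ) ) for all t ≥ 0. -/

import Mathlib

/-- A comparison function of class 𝒦: continuous and strictly increasing on [0,∞) with γ(0)=0. -/
def IsKFun (γ : ℝ → ℝ) : Prop :=
  ContinuousOn γ (Set.Ici 0) ∧ StrictMonoOn γ (Set.Ici 0) ∧ γ 0 = 0

/-- Class 𝒦∞: a 𝒦 function that is unbounded. -/
def IsKInfFun (γ : ℝ → ℝ) : Prop :=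
  IsKFun γ ∧ Filter.Tendsto γ Filter.atTop Filter.atTop

/-- The sup-norm of a disturbance u : [0,∞) → ℝ. -/
noncomputable def supNorm (u : ℝ → ℝ) : ℝ :=
  sSup ((fun t => |u t|) '' Set.Ici 0)

open Set Filter Topology

theorem IsKFun.nonneg {γ : ℝ → ℝ} (h : IsKFun γ) {r : ℝ} (hr : 0 ≤ r) : 0 ≤ γ r := by
  have := h.2.1.monotoneOn (mem_Ici.2 le_rfl) (mem_Ici.2 hr) hr
  rwa [h.2.2] at this

theorem image_abs_shift_subset (u : ℝ → ℝ) {τ : ℝ} (hτ : 0 ≤ τ) :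
    (fun t => |u (t + τ)|) '' Ici 0 ⊆ (fun t => |u t|) '' Ici 0 := by
  rintro _ ⟨t, ht, rfl⟩
  exact ⟨t + τ, add_nonneg ht hτ, rfl⟩

theorem supNorm_nonneg (u : ℝ → ℝ) : 0 ≤ supNorm u := by
  apply Real.sSup_nonneg
  rintro _ ⟨t, -, rfl⟩
  exact abs_nonneg _

theorem supNorm_shift_le {u : ℝ → ℝ} (hu : BddAbove ((fun t => |u t|) '' Ici 0)) {τ : ℝ}
    (hτ : 0 ≤ τ) : supNorm (fun s => u (s + τ)) ≤ supNorm u :=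
  csSup_le_csSup hu (nonempty_Ici.image _) (image_abs_shift_subset u hτ)

theorem exists_neg_eventually_le_of_limsup_neg {ι : Type*} {f : ι → ℝ} {l : Filter ι}
    (h : limsup f l < 0) : ∃ a < 0, ∀ᶠ t in l, f t ≤ a := by
  rw [limsup_eq] at h
  by_contra hcon
  refine h.not_ge (Real.sInf_nonneg fun a ha => ?_)
  by_contra! ha0
  exact hcon ⟨a, ha0, ha⟩

/-- A continuous function whose right slopes are frequently small at every interior point does
not increase. -/
theorem le_left_of_liminf_slope_right_nonpos {W : ℝ → ℝ} {a b : ℝ} (hab : a < b)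
    (hW : ContinuousOn W (Icc a b))
    (hslope : ∀ s ∈ Ioo a b, ∀ r, 0 < r → ∃ᶠ z in 𝓝[>] s, slope W s z < r) :
    W b ≤ W a := by
  have hle : ∀ s ∈ Ioo a b, W b ≤ W s := fun s hs =>
    image_le_of_liminf_slope_right_le_deriv_boundary (B := fun _ => W s) (B' := fun _ => 0)
      (hW.mono (Icc_subset_Icc_left hs.1.le)) le_rfl continuousOn_const
      (fun x _ => hasDerivWithinAt_const x _ _)
      (fun x hx r hr => hslope x ⟨hs.1.trans_le hx.1, hx.2⟩ r hr) (right_mem_Icc.2 hs.2.le)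
  have htend : Tendsto W (𝓝[>] a) (𝓝 (W a)) := by
    rw [← nhdsWithin_Ioo_eq_nhdsGT hab]
    exact (hW a (left_mem_Icc.2 hab.le)).mono Ioo_subset_Icc_self
  exact ge_of_tendsto htend (by filter_upwards [Ioo_mem_nhdsGT hab] with s hs using hle s hs)

/-- forward invariance of the sublevel set M_u := { x : dist(x,Θ) ≤ r₀ and
V(x) ≤ ψ̄(χ(‖u‖∞)) } under the cocycle family φ_u, given a local input-to-state Lyapunov
function V with sandwich bounds ψ̲(dist(x,Θ)) ≤ V(x) ≤ ψ̄(dist(x,Θ)) and the Dini decay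
condition on { χ(‖u‖∞) ≤ dist(x,Θ) < r₀ }, provided ψ̲⁻¹(ψ̄(χ(‖u‖∞))) < r₀; in particular
dist(φ_u(t,x),Θ) ≤ ψ̲⁻¹(ψ̄(χ(‖u‖∞))) for all t ≥ 0. -/
theorem stmt17 {X : Type*} [NormedAddCommGroup X] [NormedSpace ℝ X]
    (Θ : Set X) (hne : Θ.Nonempty) (hcomp : IsCompact Θ)
    (φ : (ℝ → ℝ) → ℝ → X → X)
    (ha : ∀ u : ℝ → ℝ, BddAbove ((fun t => |u t|) '' Set.Ici 0) → ∀ x : X, φ u 0 x = x)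
    (hb : ∀ u : ℝ → ℝ, BddAbove ((fun t => |u t|) '' Set.Ici 0) → ∀ x : X,
      ContinuousOn (fun t => φ u t x) (Set.Ici 0))
    (hcoc : ∀ u : ℝ → ℝ, BddAbove ((fun t => |u t|) '' Set.Ici 0) →
      ∀ t : ℝ, 0 ≤ t → ∀ τ : ℝ, 0 ≤ τ → ∀ x : X,
        φ u (t + τ) x = φ (fun s => u (s + τ)) t (φ u τ x))
    (r₀ : ℝ) (hr₀ : 0 < r₀)
    (V : X → ℝ)
    (hVnn : ∀ x : X, Metric.infDist x Θ ≤ r₀ → 0 ≤ V x)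
    (hVlip : ∀ x y : X, Metric.infDist x Θ ≤ r₀ → Metric.infDist y Θ ≤ r₀ →
      |V x - V y| ≤ ‖x - y‖)
    (ψ₁ ψ₂ : ℝ → ℝ) (hψ₁ : IsKInfFun ψ₁) (hψ₂ : IsKInfFun ψ₂)
    (hsand : ∀ x : X, Metric.infDist x Θ ≤ r₀ →
      ψ₁ (Metric.infDist x Θ) ≤ V x ∧ V x ≤ ψ₂ (Metric.infDist x Θ))
    (ψinv : ℝ → ℝ)
    (hψinv_nn : ∀ r : ℝ, 0 ≤ r → 0 ≤ ψinv r)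
    (hψinv_left : ∀ r : ℝ, 0 ≤ r → ψinv (ψ₁ r) = r)
    (hψinv_right : ∀ r : ℝ, 0 ≤ r → ψ₁ (ψinv r) = r)
    (α χ : ℝ → ℝ) (hα : IsKInfFun α) (hχ : IsKInfFun χ)
    (hdecay : ∀ u : ℝ → ℝ, BddAbove ((fun t => |u t|) '' Set.Ici 0) → ∀ x : X,
      χ (supNorm u) ≤ Metric.infDist x Θ → Metric.infDist x Θ < r₀ →
      Filter.limsup (fun t => (V (φ u t x) - V x) / t) (nhdsWithin 0 (Set.Ioi 0)) ≤
        -α (Metric.infDist x Θ))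
    (u : ℝ → ℝ) (hu : BddAbove ((fun t => |u t|) '' Set.Ici 0))
    (hsmall : ψinv (ψ₂ (χ (supNorm u))) < r₀) :
    ∀ x : X, Metric.infDist x Θ ≤ r₀ ∧ V x ≤ ψ₂ (χ (supNorm u)) →
      ∀ t : ℝ, 0 ≤ t →
        (Metric.infDist (φ u t x) Θ ≤ r₀ ∧ V (φ u t x) ≤ ψ₂ (χ (supNorm u))) ∧
        Metric.infDist (φ u t x) Θ ≤ ψinv (ψ₂ (χ (supNorm u))) := by
  set c := ψ₂ (χ (supNorm u)) with hc
  have hχ0 : 0 ≤ χ (supNorm u) := hχ.1.nonneg (supNorm_nonneg u)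
  have hc0 : 0 ≤ c := hψ₂.1.nonneg hχ0
  have hdist : ∀ y, Metric.infDist y Θ ≤ r₀ → V y ≤ c → Metric.infDist y Θ ≤ ψinv c := by
    intro y hy hVy
    by_contra! hlt
    have h := hψ₁.1.2.1 (mem_Ici.2 (hψinv_nn c hc0)) (mem_Ici.2 Metric.infDist_nonneg) hlt
    rw [hψinv_right c hc0] at h
    linarith [(hsand y hy).1]
  have hVcont : ContinuousOn V {y | Metric.infDist y Θ ≤ r₀} := by
    refine LipschitzOnWith.continuousOn (K := 1) (LipschitzOnWith.of_dist_le_mul ?_)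
    intro y hy z hz
    simpa [Real.dist_eq, dist_eq_norm] using hVlip y z hy hz
  have hMclosed : IsClosed {y | Metric.infDist y Θ ≤ r₀ ∧ V y ≤ c} :=
    hVcont.preimage_isClosed_of_isClosed
      (isClosed_le (Metric.continuous_infDist_pt Θ) continuous_const) isClosed_Iic
  intro x hx t ht
  have hφ := hb u hu x
  have hdcont : ContinuousOn (fun s => Metric.infDist (φ u s x) Θ) (Ici 0) :=
    (Metric.continuous_infDist_pt Θ).comp_continuousOn hφ
  have hslope : ∀ s, 0 ≤ s → Metric.infDist (φ u s x) Θ < r₀ → c < V (φ u s x) →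
      ∀ r, 0 < r → ∃ᶠ z in 𝓝[>] s, slope (fun s => V (φ u s x)) s z < r := by
    intro s hs hsr hsV r hr
    have hχlt : χ (supNorm u) < Metric.infDist (φ u s x) Θ := by
      by_contra! hle
      have h := hψ₂.1.2.1.monotoneOn (mem_Ici.2 Metric.infDist_nonneg) (mem_Ici.2 hχ0) hle
      linarith [(hsand _ hsr.le).2]
    have hχle : χ (supNorm fun v => u (v + s)) ≤ χ (supNorm u) :=
      hχ.1.2.1.monotoneOn (mem_Ici.2 (supNorm_nonneg _)) (mem_Ici.2 (supNorm_nonneg _))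
        (supNorm_shift_le hu hs)
    have hα0 : 0 < α (Metric.infDist (φ u s x) Θ) := by
      have h := hα.1.2.1 (mem_Ici.2 le_rfl) (mem_Ici.2 Metric.infDist_nonneg)
        (hχ0.trans_lt hχlt)
      rwa [hα.1.2.2] at h
    obtain ⟨a, ha0, hev⟩ := exists_neg_eventually_le_of_limsup_neg
      ((hdecay _ (hu.mono (image_abs_shift_subset u hs)) _ (hχle.trans hχlt.le) hsr).trans_lt
        (neg_neg_of_pos hα0))
    have htend : Tendsto (fun z => z - s) (𝓝[>] s) (𝓝[>] 0) := by
      refine tendsto_nhdsWithin_iff.2 ⟨?_, ?_⟩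
      · exact ((continuous_sub_right s).tendsto' s 0 (sub_self s)).mono_left nhdsWithin_le_nhds
      · filter_upwards [self_mem_nhdsWithin] with z hz using mem_Ioi.2 (sub_pos.2 (mem_Ioi.1 hz))
    refine Eventually.frequently ?_
    filter_upwards [htend.eventually hev, self_mem_nhdsWithin] with z hz hzs
    have hz0 : 0 ≤ z - s := (sub_pos.2 hzs).le
    rw [← hcoc u hu (z - s) hz0 s hs x, sub_add_cancel] at hz
    rw [slope_def_field]
    linarith
  have hmem : Icc 0 t ⊆ {s | φ u s x ∈ {y | Metric.infDist y Θ ≤ r₀ ∧ V y ≤ c}} := by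
    refine IsClosed.Icc_subset_of_forall_exists_gt ?_ ?_ ?_
    · rw [inter_comm]
      exact (hφ.mono Icc_subset_Ici_self).preimage_isClosed_of_isClosed isClosed_Icc hMclosed
    · simpa only [mem_ofPred_eq, ha u hu x] using hx
    · rintro s ⟨⟨hsr, hsV⟩, hs0, -⟩ y hy
      by_contra hempty
      have hnear : ∀ᶠ z in 𝓝[≥] s, Metric.infDist (φ u z x) Θ < r₀ :=
        ((hdcont s hs0).mono (Ici_subset_Ici.2 hs0)).eventually_lt_const
          ((hdist _ hsr hsV).trans_lt hsmall)
      obtain ⟨b, hsb, hb'⟩ := (mem_nhdsGE_iff_exists_Icc_subset).1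
        (hnear.and (Icc_mem_nhdsGE hy))
      have hout : ∀ z ∈ Ioc s b, c < V (φ u z x) := by
        intro z hz
        by_contra! hle
        have hz' := hb' ⟨hz.1.le, hz.2⟩
        exact hempty ⟨z, ⟨hz'.1.le, hle⟩, hz.1, hz'.2.2⟩
      have hWcont : ContinuousOn (fun z => V (φ u z x)) (Icc s b) :=
        hVcont.comp (hφ.mono fun z hz => hs0.trans hz.1) fun z hz => (hb' hz).1.le
      have hVb := le_left_of_liminf_slope_right_nonpos hsb hWcont fun z hz =>
        hslope z (hs0.trans hz.1.le) (hb' (Ioo_subset_Icc_self hz)).1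
          (hout z (Ioo_subset_Ioc_self hz))
      exact (hout b ⟨hsb, le_rfl⟩).not_ge (hVb.trans hsV)
  have htM := hmem (right_mem_Icc.2 ht)
  exact ⟨htM, hdist _ htM.1 htM.2⟩
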